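/- Let X be a nested almost convex set with convex layers R_1, …, R_k, let 1 ≤ j ≤ k−1, and suppose m = |R_{j+1}| ≥ 4. Let q : {0,…,m−1} → R_{j+1} be a counterclockwise enumeration, and for each index i (taken modulo m) let T_i denote the interior of conv{q_i, q_{i+1}, q_{i+2}}. Then for every p ∈ R_j there exists an index i such that p ∈ T_i and p ∈ T_{i+1}, while p ∉ T_l for every index l ∉ {i, i+1} (mod m); i.e., each point of R_j lies in exactly two of the triangles T_0, …, T_{m−1}, and these two triangles are consecutive. -/

import Mathlib

open Set

noncomputable section

/-- Points of the plane. -/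
abbrev Pt : Type := ℝ × ℝ

/-- The orientation determinant of the triple `(a, b, c)`:
`c` lies strictly to the left of the directed line from `a` to `b` iff `orient a b c > 0`. -/
def orient (a b c : Pt) : ℝ :=
  (b.1 - a.1) * (c.2 - a.2) - (b.2 - a.2) * (c.1 - a.1)

/-- A set of points is in general position if no three pairwise distinct points are collinear. -/
def GenPos (X : Set Pt) : Prop :=
  ∀ a ∈ X, ∀ b ∈ X, ∀ c ∈ X, a ≠ b → a ≠ c → b ≠ c → orient a b c ≠ 0

/-- The set of extreme points of the convex hull of `S`. -/
def extremePts (S : Set Pt) : Set Pt := Set.extremePoints ℝ (convexHull ℝ S)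

/-- Remove the extreme points of the convex hull (one peeling step of convex layers). -/
def peel (S : Set Pt) : Set Pt := S \ extremePts S

/-- `X` has exactly `k` convex layers. -/
def HasLayers (X : Set Pt) (k : ℕ) : Prop :=
  peel^[k] X = ∅ ∧ ∀ j < k, peel^[j] X ≠ ∅

/-- `X_j`, the union of the `j` innermost convex layers (when `X` has `k` layers). -/
def layerSub (X : Set Pt) (k j : ℕ) : Set Pt := peel^[k - j] X

/-- `R_j`, the `j`-th convex layer of `X` (when `X` has `k` layers), `R_1` innermost. -/
def layer (X : Set Pt) (k j : ℕ) : Set Pt := extremePts (layerSub X k j)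

/-- `X` is a nested almost convex set. -/
def IsNACS (X : Set Pt) : Prop :=
  X.Finite ∧ X.Nonempty ∧ GenPos X ∧
  ∀ k, HasLayers X k →
    ∀ j, 1 ≤ j → j ≤ k →
      ∀ a ∈ layer X k j, ∀ b ∈ layer X k j, ∀ c ∈ layer X k j,
        a ≠ b → a ≠ c → b ≠ c →
        ∃! p : Pt, p ∈ layerSub X k (j - 1) ∩ interior (convexHull ℝ ({a, b, c} : Set Pt))

/-- `q` is a counterclockwise enumeration of `S`. -/
def CCWEnum {m : ℕ} (S : Set Pt) (q : Fin m → Pt) : Prop :=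
  Function.Injective q ∧ Set.range q = S ∧
  ∀ a b c : Fin m, a < b → b < c → 0 < orient (q a) (q b) (q c)

/-- The ordered pair `(q1, q2)` of points of `R` is adoptable from `p`. -/
def AdoptablePair (R : Set Pt) (p q1 q2 : Pt) : Prop :=
  ∀ q3 ∈ R \ ({q1, q2} : Set Pt), p ∈ interior (convexHull ℝ ({q1, q2, q3} : Set Pt))

/-- The `i`-th binary string of length `j` in lexicographic order (`false` before `true`). -/
def strOfNat (j i : ℕ) : List Bool :=
  (List.range j).map fun t => i.testBit (j - 1 - t)

/-- The numeric (lexicographic) rank of a binary string among strings of its length. -/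
def natOfStr (s : List Bool) : ℕ := s.foldl (fun n b => 2 * n + b.toNat) 0

/-- The leftmost `k`-level descendant of the node `s`. -/
def firstStr (k : ℕ) (s : List Bool) : List Bool := s ++ List.replicate (k - s.length) false

/-- The rightmost `k`-level descendant of the node `s`. -/
def lastStr (k : ℕ) (s : List Bool) : List Bool := s ++ List.replicate (k - s.length) true

/-- Non-root nodes of the tree `T₁(k)`: binary strings of length `1..k`. -/
def ValidNode1 (k : ℕ) (s : List Bool) : Prop := 1 ≤ s.length ∧ s.length ≤ k

/-- A type-1 labeling of `X`, given by its label function `x` (the inverse of `ψ`). -/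
def IsLabeling1 (k : ℕ) (X : Set Pt) (x : List Bool → Pt) : Prop :=
  Set.InjOn x {s | ValidNode1 k s} ∧ x '' {s | ValidNode1 k s} = X

/-- A type-1 labeling is nested. -/
def Nested1 (k : ℕ) (X : Set Pt) (x : List Bool → Pt) : Prop :=
  ∀ j, 1 ≤ j → j ≤ k →
    CCWEnum (layer X k j) fun i : Fin (2 ^ j) => x (strOfNat j i.val)

/-- A type-1 labeling is adoptable. -/
def Adoptable1 (k : ℕ) (X : Set Pt) (x : List Bool → Pt) : Prop :=
  ∀ s : List Bool, 1 ≤ s.length → s.length + 1 ≤ k →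
    AdoptablePair (layer X k (s.length + 1)) (x s) (x (s ++ [false])) (x (s ++ [true]))

/-- `previous[R_k(u)]` for a type-1 labeling: the cyclic predecessor (in the left-to-right,
i.e. counterclockwise, order of the `k`-level) of `first[R_k(u)]`. -/
def prev1 (k : ℕ) (x : List Bool → Pt) (s : List Bool) : Pt :=
  x (strOfNat k ((natOfStr (firstStr k s) + (2 ^ k - 1)) % 2 ^ k))

/-- `next[R_k(u)]` for a type-1 labeling: the cyclic successor of `last[R_k(u)]`. -/
def next1 (k : ℕ) (x : List Bool → Pt) (s : List Bool) : Pt :=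
  x (strOfNat k ((natOfStr (lastStr k s) + 1) % 2 ^ k))

/-- A type-1 labeling is well laid. -/
def WellLaid1 (k : ℕ) (x : List Bool → Pt) : Prop :=
  ∀ s : List Bool, 1 ≤ s.length → s.length ≤ k →
    x s ∈ convexHull ℝ ({prev1 k x s, x (firstStr k s), x (lastStr k s)} : Set Pt) ∧
    x s ∈ convexHull ℝ ({x (firstStr k s), x (lastStr k s), next1 k x s} : Set Pt)

/-- `X_u` for a type-1 labeling: the labels of the proper descendants of `s`. -/
def descSet1 (k : ℕ) (x : List Bool → Pt) (s : List Bool) : Set Pt :=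
  x '' {t | ValidNode1 k t ∧ s <+: t ∧ s ≠ t}

/-- `X̄_u = X_u ∪ {x_u}` for a type-1 labeling. -/
def barSet1 (k : ℕ) (x : List Bool → Pt) (s : List Bool) : Set Pt :=
  insert (x s) (descSet1 k x s)

/-- A type-1 labeling is an internal separation. -/
def InternalSep1 (k : ℕ) (X : Set Pt) (x : List Bool → Pt) : Prop :=
  ∀ s : List Bool, s.length + 1 ≤ k →
    ∀ y ∈ X \ descSet1 k x s,
      ∀ a ∈ barSet1 k x (s ++ [false]), ∀ b ∈ barSet1 k x (s ++ [true]),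
        0 < orient a b y

/-- A type-1 labeling is an external separation. -/
def ExternalSep1 (k : ℕ) (X : Set Pt) (x : List Bool → Pt) : Prop :=
  ∀ s : List Bool, 1 ≤ s.length → s.length + 1 ≤ k →
    ∀ y ∈ X \ barSet1 k x s,
      (∀ a ∈ barSet1 k x (s ++ [false]), 0 < orient a (x s) y) ∧
      (∀ b ∈ barSet1 k x (s ++ [true]), 0 < orient (x s) b y)

/-- Nodes of the tree `T₂(k)`: the root `none`, and pairs `(c, s)`. -/
abbrev Node2 : Type := Option (Fin 3 × List Bool)

/-- Valid nodes of `T₂(k)`: the root, and pairs `(c, s)` with `|s| ≤ k - 2`. -/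
def ValidNode2 (k : ℕ) : Node2 → Prop
  | none => True
  | some (_, s) => s.length + 2 ≤ k

/-- A type-2 labeling of `X`, given by its label function `x` (the inverse of `ψ`). -/
def IsLabeling2 (k : ℕ) (X : Set Pt) (x : Node2 → Pt) : Prop :=
  Set.InjOn x {u | ValidNode2 k u} ∧ x '' {u | ValidNode2 k u} = X

/-- The `i`-th node (left-to-right) of the `(j+2)`-level of `T₂(k)`. -/
def node2At (j i : ℕ) : Node2 :=
  some (⟨i / 2 ^ j % 3, by omega⟩, strOfNat j (i % 2 ^ j))

/-- A type-2 labeling is nested. -/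
def Nested2 (k : ℕ) (X : Set Pt) (x : Node2 → Pt) : Prop :=
  CCWEnum (layer X k 1) (fun _ : Fin 1 => x none) ∧
  ∀ j : ℕ, j + 2 ≤ k →
    CCWEnum (layer X k (j + 2)) fun i : Fin (3 * 2 ^ j) => x (node2At j i.val)

/-- A type-2 labeling is adoptable. -/
def Adoptable2 (k : ℕ) (X : Set Pt) (x : Node2 → Pt) : Prop :=
  ∀ (c : Fin 3) (s : List Bool), s.length + 3 ≤ k →
    AdoptablePair (layer X k (s.length + 3)) (x (some (c, s)))
      (x (some (c, s ++ [false]))) (x (some (c, s ++ [true])))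

/-- `previous[R_k(u)]` for a type-2 labeling, `u = (c, s)`. -/
def prev2 (k : ℕ) (x : Node2 → Pt) (c : Fin 3) (s : List Bool) : Pt :=
  x (node2At (k - 2)
      ((c.val * 2 ^ (k - 2) + natOfStr (firstStr (k - 2) s) + (3 * 2 ^ (k - 2) - 1)) %
        (3 * 2 ^ (k - 2))))

/-- `next[R_k(u)]` for a type-2 labeling, `u = (c, s)`. -/
def next2 (k : ℕ) (x : Node2 → Pt) (c : Fin 3) (s : List Bool) : Pt :=
  x (node2At (k - 2)
      ((c.val * 2 ^ (k - 2) + natOfStr (lastStr (k - 2) s) + 1) % (3 * 2 ^ (k - 2))))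

/-- A type-2 labeling is well laid (the root is the only node with `R_k(u) = R_k`). -/
def WellLaid2 (k : ℕ) (x : Node2 → Pt) : Prop :=
  ∀ (c : Fin 3) (s : List Bool), s.length + 2 ≤ k →
    x (some (c, s)) ∈ convexHull ℝ
      ({prev2 k x c s, x (some (c, firstStr (k - 2) s)),
        x (some (c, lastStr (k - 2) s))} : Set Pt) ∧
    x (some (c, s)) ∈ convexHull ℝ
      ({x (some (c, firstStr (k - 2) s)), x (some (c, lastStr (k - 2) s)),
        next2 k x c s} : Set Pt)

/-- `X_u` for a type-2 labeling and a non-root node `u = (c, s)`. -/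
def descSet2 (k : ℕ) (x : Node2 → Pt) (c : Fin 3) (s : List Bool) : Set Pt :=
  x '' {u | ∃ t : List Bool, u = some (c, t) ∧ t.length + 2 ≤ k ∧ s <+: t ∧ s ≠ t}

/-- `X̄_u = X_u ∪ {x_u}` for a type-2 labeling and a non-root node `u = (c, s)`. -/
def barSet2 (k : ℕ) (x : Node2 → Pt) (c : Fin 3) (s : List Bool) : Set Pt :=
  insert (x (some (c, s))) (descSet2 k x c s)

/-- A type-2 labeling is an internal separation. -/
def InternalSep2 (k : ℕ) (X : Set Pt) (x : Node2 → Pt) : Prop :=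
  (∀ (c : Fin 3) (s : List Bool), s.length + 3 ≤ k →
    ∀ y ∈ X \ descSet2 k x c s,
      ∀ a ∈ barSet2 k x c (s ++ [false]), ∀ b ∈ barSet2 k x c (s ++ [true]),
        0 < orient a b y) ∧
  (∀ i : Fin 3,
    ∀ y ∈ X \ (barSet2 k x i [] ∪ barSet2 k x (i + 1) []),
      ∀ a ∈ barSet2 k x i [], ∀ b ∈ barSet2 k x (i + 1) [],
        0 < orient a b y)

/-- A type-2 labeling is an external separation. -/
def ExternalSep2 (k : ℕ) (X : Set Pt) (x : Node2 → Pt) : Prop :=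
  ∀ (c : Fin 3) (s : List Bool), s.length + 3 ≤ k →
    ∀ y ∈ X \ barSet2 k x c s,
      (∀ a ∈ barSet2 k x c (s ++ [false]), 0 < orient a (x (some (c, s))) y) ∧
      (∀ b ∈ barSet2 k x c (s ++ [true]), 0 < orient (x (some (c, s))) b y)

/-- One corner-refinement step: from `α_s = (q, o, p)` to `α_{s0}` (for `b = false`)
or `α_{s1}` (for `b = true`). -/
def cornerStep (α : Pt × Pt × Pt) (b : Bool) : Pt × Pt × Pt :=
  let q := α.1
  let o := α.2.1
  let p := α.2.2
  if b then (o + (1 / 5 : ℝ) • (q - o), o + (1 / 5 : ℝ) • (p - o), o + (2 / 5 : ℝ) • (p - o))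
  else (o + (2 / 5 : ℝ) • (q - o), o + (1 / 5 : ℝ) • (q - o), o + (1 / 5 : ℝ) • (p - o))

/-- The corner `α_s = (q_s, o_s, p_s)` assigned to the binary string `s` (with parameter `k`). -/
def corner (k : ℕ) (s : List Bool) : Pt × Pt × Pt :=
  s.foldl cornerStep
    (((0 : ℝ), (2 * 5 ^ (k + 1) : ℝ)), ((0 : ℝ), (0 : ℝ)), ((2 * 5 ^ (k + 1) : ℝ), (0 : ℝ)))

/-- The point `y_v` for a binary string `v = s ++ [b]` of positive length. -/
def ypt (k : ℕ) (v : List Bool) : Pt :=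
  let α := corner k v.dropLast
  if v.getLastD false then α.2.1 + (1 / 5 : ℝ) • (α.2.2 - α.2.1)
  else α.2.1 + (1 / 5 : ℝ) • (α.1 - α.2.1)

/-- The point `x_s`: the midpoint of `y_{s·0^(k+1−|s|)}` and `y_{s·1^(k+1−|s|)}`. -/
def xpt (k : ℕ) (s : List Bool) : Pt :=
  (1 / 2 : ℝ) •
    (ypt k (s ++ List.replicate (k + 1 - s.length) false) +
      ypt k (s ++ List.replicate (k + 1 - s.length) true))

/-- The (interior of the) triangle determined by the enumerated points of index
`n, n+1, n+2` (taken modulo `m`). -/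
def triAt {m : ℕ} (hm : 0 < m) (q : Fin m → Pt) (n : ℕ) : Set Pt :=
  interior (convexHull ℝ
    ({q ⟨n % m, Nat.mod_lt _ hm⟩, q ⟨(n + 1) % m, Nat.mod_lt _ hm⟩,
      q ⟨(n + 2) % m, Nat.mod_lt _ hm⟩} : Set Pt))

lemma orient_comb (a b x y : Pt) (s t : ℝ) (h : s + t = 1) :
    orient a b (s • x + t • y) = s * orient a b x + t * orient a b y := by
  have : s = 1 - t := by linarith
  subst this
  simp only [orient, Prod.fst_add, Prod.snd_add, Prod.smul_fst, Prod.smul_snd, smul_eq_mul]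
  ring

lemma orient_cyc (a b c : Pt) : orient a b c = orient b c a := by
  simp only [orient]; ring

lemma orient_swap (a b c : Pt) : orient b a c = - orient a b c := by
  simp only [orient]; ring

lemma orient_self_left (a b : Pt) : orient a b a = 0 := by
  simp only [orient]; ring

lemma orient_self_right (a b : Pt) : orient a b b = 0 := by
  simp only [orient]; ring

lemma orient_nonneg_hull (a b : Pt) (S : Set Pt) (h : ∀ x ∈ S, 0 ≤ orient a b x) :
    ∀ x ∈ convexHull ℝ S, 0 ≤ orient a b x := by
  have hc : Convex ℝ {x | 0 ≤ orient a b x} := by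
    intro x hx y hy s t hs ht hst
    simp only [Set.mem_ofPred_eq] at *
    rw [orient_comb a b x y s t hst]
    positivity
  intro x hx
  exact convexHull_min (t := {x | 0 ≤ orient a b x}) h hc hx

lemma orient_pos_interior (a b : Pt) (S : Set Pt) (h : ∀ x ∈ S, 0 ≤ orient a b x)
    (c : Pt) (hc : 0 < orient a b c) :
    ∀ x ∈ interior (convexHull ℝ S), 0 < orient a b x := by
  intro z hz
  have hcont : Filter.Tendsto (fun t : ℝ => (1 + t) • z + (-t) • c) (nhdsWithin 0 (Set.Ioi 0)) (nhds z) := by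
    have : Continuous (fun t : ℝ => (1 + t) • z + (-t) • c) := by fun_prop
    have h2 := this.tendsto 0
    simp only [add_zero, one_smul, neg_zero, zero_smul] at h2
    exact h2.mono_left nhdsWithin_le_nhds
  have hev : ∀ᶠ t in nhdsWithin (0:ℝ) (Set.Ioi 0), (1 + t) • z + (-t) • c ∈ convexHull ℝ S :=
    hcont (mem_interior_iff_mem_nhds.mp hz)
  obtain ⟨t, ht, ht0⟩ := (hev.and self_mem_nhdsWithin).exists
  have h3 := orient_nonneg_hull a b S h _ ht
  rw [orient_comb a b z c _ _ (by ring)] at h3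
  have ht0' : 0 < t := ht0
  have : 0 < t * orient a b c := by positivity
  by_contra hn
  push Not at hn
  nlinarith

lemma mem_tri_iff (a b c z : Pt) (h : 0 < orient a b c) :
    z ∈ interior (convexHull ℝ ({a, b, c} : Set Pt)) ↔
      0 < orient a b z ∧ 0 < orient b c z ∧ 0 < orient c a z := by
  constructor
  · intro hz
    have h1 : 0 < orient b c a := by rw [← orient_cyc]; exact h
    have h2 : 0 < orient c a b := by rw [← orient_cyc]; exact h1
    refine ⟨orient_pos_interior a b _ ?_ c h z hz, orient_pos_interior b c _ ?_ a h1 z hz,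
      orient_pos_interior c a _ ?_ b h2 z hz⟩
    all_goals
      rintro x (rfl | rfl | rfl) <;>
      simp only [orient_self_left, orient_self_right, le_refl, le_of_lt, *]
  · rintro hz
    have hopen : IsOpen {z : Pt | 0 < orient a b z ∧ 0 < orient b c z ∧ 0 < orient c a z} := by
      simp only [orient, Set.ofPred_and]
      refine IsOpen.inter ?_ (IsOpen.inter ?_ ?_) <;>
      exact isOpen_lt (by fun_prop) (by fun_prop)
    refine interior_maximal ?_ hopen hz
    rintro w ⟨w1, w2, w3⟩
    rw [convexHull_insert (by simp), convexHull_pair]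
    have hs : orient a b w + orient b c w + orient c a w = orient a b c := by
      simp only [orient]; ring
    set u := orient a b w
    set v := orient b c w
    set r := orient c a w
    have hur : 0 < u + r := by linarith
    simp only [mem_convexJoin, Set.mem_singleton_iff, exists_eq_left]
    refine ⟨(r / (u + r)) • b + (u / (u + r)) • c, ⟨r / (u + r), u / (u + r), by positivity, by positivity, by field_simp; ring, rfl⟩, ?_⟩
    refine ⟨v / orient a b c, (u + r) / orient a b c, by positivity, by positivity, by rw [← hs]; field_simp; ring, ?_⟩
    have key1 : v * a.1 + r * b.1 + u * c.1 = orient a b c * w.1 := by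
      simp only [u, v, r, orient]; ring
    have key2 : v * a.2 + r * b.2 + u * c.2 = orient a b c * w.2 := by
      simp only [u, v, r, orient]; ring
    have h0 : orient a b c ≠ 0 := h.ne'
    ext
    · simp only [Prod.fst_add, Prod.smul_fst, smul_eq_mul]
      field_simp
      linarith
    · simp only [Prod.snd_add, Prod.smul_snd, smul_eq_mul]
      field_simp
      linarith

lemma extremePts_subset (S : Set Pt) : extremePts S ⊆ S := extremePoints_convexHull_subset

lemma hull_extremePts (S : Set Pt) (hS : S.Finite) :
    convexHull ℝ (extremePts S) = convexHull ℝ S := by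
  have h1 := closure_convexHull_extremePoints (s := convexHull ℝ S)
    (hS.isCompact_convexHull ℝ) (convex_convexHull ℝ S)
  have h2 : (extremePts S).Finite := hS.subset (extremePts_subset S)
  rw [← h1]
  exact (h2.isClosed_convexHull ℝ).closure_eq.symm

/-- Interlacing count. -/
lemma card_inner (Y : Set Pt) (hY : Y.Finite) (hG : GenPos Y)
    (h : ∀ a ∈ extremePts Y, ∀ b ∈ extremePts Y, ∀ c ∈ extremePts Y,
      a ≠ b → a ≠ c → b ≠ c →
      ∃ p, p ∈ peel Y ∩ interior (convexHull ℝ ({a, b, c} : Set Pt))) :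
    (extremePts Y).ncard ≤ (peel Y).ncard + 2 := by
  classical
  rcases (extremePts Y).eq_empty_or_nonempty with he | ⟨a, ha⟩
  · simp [he]
  have haY := extremePts_subset Y ha
  have hRf : (extremePts Y).Finite := hY.subset (extremePts_subset Y)
  have hZf : (peel Y).Finite := hY.subset Set.sdiff_subset
  have hnot : a ∉ convexHull ℝ (Y \ {a}) := by
    have h1 := ((convex_convexHull ℝ Y).mem_extremePoints_iff_mem_sdiff_convexHull_sdiff).1 ha
    intro h2
    exact h1.2 (convexHull_mono (Set.sdiff_subset_sdiff_left (subset_convexHull ℝ Y)) h2)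
  obtain ⟨φ, u, hu1, hu2⟩ := geometric_hahn_banach_point_closed (convex_convexHull ℝ (Y \ {a}))
    ((hY.subset Set.sdiff_subset).isClosed_convexHull ℝ) hnot
  obtain ⟨α, β, hφ⟩ : ∃ α β : ℝ, ∀ x : Pt, φ x = α * x.1 + β * x.2 := by
    refine ⟨φ (1, 0), φ (0, 1), fun x => ?_⟩
    have : x = x.1 • ((1 : ℝ), (0 : ℝ)) + x.2 • ((0 : ℝ), (1 : ℝ)) := by
      ext <;> simp
    conv_lhs => rw [this]
    rw [map_add, map_smul, map_smul, smul_eq_mul, smul_eq_mul]; ring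
  have hpos : ∀ y ∈ Y, y ≠ a → 0 < α * (y.1 - a.1) + β * (y.2 - a.2) := by
    intro y hy hya
    have h1 := hu2 y (subset_convexHull ℝ _ ⟨hy, hya⟩)
    rw [hφ] at h1 hu1
    linarith
  let f : Pt → ℝ := fun z =>
    (α * (z.2 - a.2) - β * (z.1 - a.1)) / (α * (z.1 - a.1) + β * (z.2 - a.2))
  have hlt : ∀ b ∈ Y, ∀ c ∈ Y, b ≠ a → c ≠ a → (f b < f c ↔ 0 < orient a b c) := by
    intro b hb c hc hba hca
    have h1 := hpos b hb hba
    have h2 := hpos c hc hca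
    have h3 : 0 < α ^ 2 + β ^ 2 := by
      by_contra hn
      have ha0 : α = 0 := by nlinarith [sq_nonneg α, sq_nonneg β]
      have hb0 : β = 0 := by nlinarith [sq_nonneg α, sq_nonneg β]
      simp [ha0, hb0] at h1
    have h4 : (α * (c.2 - a.2) - β * (c.1 - a.1)) * (α * (b.1 - a.1) + β * (b.2 - a.2)) -
        (α * (b.2 - a.2) - β * (b.1 - a.1)) * (α * (c.1 - a.1) + β * (c.2 - a.2)) =
        (α ^ 2 + β ^ 2) * orient a b c := by
      simp only [orient]; ring
    simp only [f]
    rw [div_lt_div_iff₀ h1 h2]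
    constructor
    · intro h5
      have : 0 < (α ^ 2 + β ^ 2) * orient a b c := by linarith
      exact (mul_pos_iff_of_pos_left h3).1 this
    · intro h5
      have : 0 < (α ^ 2 + β ^ 2) * orient a b c := by positivity
      linarith
  have hinj : ∀ b ∈ Y, ∀ c ∈ Y, b ≠ a → c ≠ a → f b = f c → b = c := by
    intro b hb c hc hba hca hf
    by_contra hbc
    have h1 := hG a haY b hb c hc hba.symm hca.symm hbc
    have h2 := (hlt b hb c hc hba hca).not.1 (by rw [hf]; exact lt_irrefl _)
    have h3 := (hlt c hc b hb hca hba).not.1 (by rw [hf]; exact lt_irrefl _)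
    have h4 : orient a c b = - orient a b c := by simp only [orient]; ring
    rw [h4] at h3
    exact h1 (by linarith)
  let S : Finset ℝ := (hRf.toFinset.erase a).image f
  let T : Finset ℝ := hZf.toFinset.image f
  have hST : S.card ≤ T.card + 1 := by
    apply Finset.card_le_of_interleaved
    intro x hx y hy hxy _
    simp only [S, Finset.mem_image, Finset.mem_erase, Set.Finite.mem_toFinset] at hx hy
    obtain ⟨b, ⟨hba, hbR⟩, rfl⟩ := hx
    obtain ⟨c, ⟨hca, hcR⟩, rfl⟩ := hy
    have hbc : b ≠ c := by rintro rfl; exact lt_irrefl _ hxy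
    have hbY := extremePts_subset Y hbR
    have hcY := extremePts_subset Y hcR
    obtain ⟨p, hpZ, hp⟩ := h a ha b hbR c hcR hba.symm hca.symm hbc
    have hpY : p ∈ Y := hpZ.1
    have hpa : p ≠ a := by rintro rfl; exact hpZ.2 ha
    have ho := (hlt b hbY c hcY hba hca).1 hxy
    obtain ⟨p1, -, p3⟩ := (mem_tri_iff a b c p ho).1 hp
    refine ⟨f p, ?_, (hlt b hbY p hpY hba hpa).2 p1, (hlt p hpY c hcY hpa hca).2 ?_⟩
    · simp only [T, Finset.mem_image, Set.Finite.mem_toFinset]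
      exact ⟨p, hpZ, rfl⟩
    · rw [orient_cyc, orient_cyc]; exact p3
  have hS : S.card = hRf.toFinset.card - 1 := by
    rw [← Finset.card_erase_of_mem ((hRf.mem_toFinset).2 ha)]
    apply Finset.card_image_of_injOn
    intro b hb c hc hf
    simp only [Finset.coe_erase, Set.Finite.coe_toFinset] at hb hc
    exact hinj b (extremePts_subset Y hb.1) c (extremePts_subset Y hc.1) hb.2 hc.2 hf
  have hT : T.card ≤ hZf.toFinset.card := Finset.card_image_le
  rw [Set.ncard_eq_toFinset_card _ hRf, Set.ncard_eq_toFinset_card _ hZf]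
  omega

/-- Periodic extension of the enumeration. -/
def perQ {m : ℕ} (hm : 0 < m) (q : Fin m → Pt) (n : ℕ) : Pt := q ⟨n % m, Nat.mod_lt _ hm⟩

lemma triAt_eq {m : ℕ} (hm : 0 < m) (q : Fin m → Pt) (n : ℕ) :
    triAt hm q n = interior (convexHull ℝ
      ({perQ hm q n, perQ hm q (n + 1), perQ hm q (n + 2)} : Set Pt)) := rfl

lemma perQ_add {m : ℕ} (hm : 0 < m) (q : Fin m → Pt) (n : ℕ) :
    perQ hm q (n + m) = perQ hm q n := by
  simp [perQ]

lemma perQ_orient {m : ℕ} (hm : 0 < m) (q : Fin m → Pt)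
    (hq : ∀ a b c : Fin m, a < b → b < c → 0 < orient (q a) (q b) (q c))
    (a b c : ℕ) (hab : a < b) (hbc : b < c) (hca : c < a + m) :
    0 < orient (perQ hm q a) (perQ hm q b) (perQ hm q c) := by
  induction a using Nat.strong_induction_on generalizing b c with
  | _ a ih =>
    by_cases ham : m ≤ a
    · have := ih (a - m) (by omega) (b - m) (c - m) (by omega) (by omega) (by omega)
      rw [← perQ_add hm q (a - m), ← perQ_add hm q (b - m), ← perQ_add hm q (c - m),
        Nat.sub_add_cancel (by omega), Nat.sub_add_cancel (by omega),
        Nat.sub_add_cancel (by omega)] at this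
      exact this
    · push Not at ham
      have base : ∀ x y z : ℕ, x < y → y < z → z < m →
          0 < orient (perQ hm q x) (perQ hm q y) (perQ hm q z) := by
        intro x y z hxy hyz hz
        apply hq
        · simp only [Fin.mk_lt_mk]
          rw [Nat.mod_eq_of_lt (by omega), Nat.mod_eq_of_lt (by omega)]; exact hxy
        · simp only [Fin.mk_lt_mk]
          rw [Nat.mod_eq_of_lt (by omega), Nat.mod_eq_of_lt (by omega)]; exact hyz
      by_cases hc : c < m
      · exact base a b c hab hbc hc
      · have hc' := perQ_add hm q (c - m)
        rw [Nat.sub_add_cancel (by omega)] at hc'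
        by_cases hb : b < m
        · rw [hc', orient_cyc, orient_cyc]
          exact base (c - m) a b (by omega) hab hb
        · have hb' := perQ_add hm q (b - m)
          rw [Nat.sub_add_cancel (by omega)] at hb'
          rw [hc', hb', orient_cyc]
          exact base (b - m) (c - m) a (by omega) (by omega) ham

lemma perQ_rep {m : ℕ} (hm : 0 < m) (q : Fin m → Pt) (s : Fin m) (i : ℕ) :
    ∃ n, i ≤ n ∧ n < i + m ∧ perQ hm q n = q s := by
  induction i with
  | zero =>
    refine ⟨s, Nat.zero_le _, by simp, ?_⟩
    simp [perQ, Nat.mod_eq_of_lt s.2]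
  | succ i ih =>
    obtain ⟨n, h1, h2, h3⟩ := ih
    rcases Nat.lt_or_ge i n with h | h
    · exact ⟨n, h, by omega, h3⟩
    · exact ⟨n + m, by omega, by omega, by rw [perQ_add, h3]⟩

lemma core (W : Set Pt) (hW : W.Finite) (hG : GenPos W) (m : ℕ) (hm4 : 4 ≤ m) (hm : 0 < m)
    (q : Fin m → Pt) (hq : CCWEnum (extremePts W) q)
    (hu : ∀ a ∈ extremePts W, ∀ b ∈ extremePts W, ∀ c ∈ extremePts W,
      a ≠ b → a ≠ c → b ≠ c →
      ∃! p, p ∈ peel W ∩ interior (convexHull ℝ ({a, b, c} : Set Pt)))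
    (hi : ∀ a ∈ extremePts (peel W), ∀ b ∈ extremePts (peel W), ∀ c ∈ extremePts (peel W),
      a ≠ b → a ≠ c → b ≠ c →
      ∃ p, p ∈ peel (peel W) ∩ interior (convexHull ℝ ({a, b, c} : Set Pt))) :
    ∀ p ∈ extremePts (peel W), ∃ i : ℕ, i < m ∧ p ∈ triAt hm q i ∧ p ∈ triAt hm q (i + 1) ∧
      ∀ l : ℕ, l < m → l ≠ i → l ≠ (i + 1) % m → p ∉ triAt hm q l := by
  classical
  obtain ⟨hinj, hrange, hccw⟩ := hq
  set Q := perQ hm q with hQ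
  have hQR : ∀ n, Q n ∈ extremePts W := fun n => hrange ▸ Set.mem_range_self _
  have hQW : ∀ n, Q n ∈ W := fun n => extremePts_subset W (hQR n)
  have hor := perQ_orient hm q hccw
  rw [← hQ] at hor
  have hYf : (peel W).Finite := hW.subset Set.sdiff_subset
  have hYW : peel W ⊆ W := Set.sdiff_subset
  have hQne : ∀ a b, a < b → b < a + m → Q a ≠ Q b := by
    intro a b hab hba he
    by_cases hb : b + 1 < a + m
    · have := hor a b (b + 1) hab (by omega) hb
      rw [he] at this
      simp [orient] at this
    · have := hor a (a + 1) b (by omega) (by omega) hba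
      rw [he] at this
      simp only [orient] at this
      nlinarith
  have hYQ : ∀ y ∈ peel W, ∀ n, Q n ≠ y := by
    rintro y hy n rfl
    exact hy.2 (hQR n)
  -- chords do not contain points of `Y`
  have hchord : ∀ y ∈ peel W, ∀ a b, a < b → b < a + m → orient (Q a) (Q b) y ≠ 0 := by
    intro y hy a b hab hba
    exact hG _ (hQW a) _ (hQW b) _ (hYW hy) (hQne a b hab hba) (hYQ y hy a) (hYQ y hy b)
  -- edges
  have hedge : ∀ y ∈ peel W, ∀ i, 0 < orient (Q i) (Q (i + 1)) y := by
    intro y hy i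
    refine lt_of_le_of_ne ?_ (hchord y hy i (i + 1) (by omega) (by omega)).symm
    apply orient_nonneg_hull (Q i) (Q (i + 1)) (extremePts W)
    · intro x hx
      rw [← hrange] at hx
      obtain ⟨s, rfl⟩ := hx
      obtain ⟨n, h1, h2, h3⟩ := perQ_rep hm q s i
      rw [← h3, ← hQ]
      rcases Nat.eq_or_lt_of_le h1 with h | h
      · rw [← h, orient_self_left]
      · rcases Nat.eq_or_lt_of_le (show i + 1 ≤ n from h) with h' | h'
        · rw [← h', orient_self_right]
        · exact (hor i (i + 1) n (by omega) h' h2).le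
    · rw [hull_extremePts W hW]
      exact subset_convexHull ℝ _ (hYW hy)
  -- membership in the triangles
  have hmem : ∀ y ∈ peel W, ∀ i, y ∈ triAt hm q i ↔ orient (Q i) (Q (i + 2)) y < 0 := by
    intro y hy i
    rw [triAt_eq, ← hQ, mem_tri_iff _ _ _ _ (hor i (i + 1) (i + 2) (by omega) (by omega) (by omega)),
      orient_swap (Q i) (Q (i + 2)) y]
    constructor
    · rintro ⟨-, -, h⟩; linarith
    · intro h; exact ⟨hedge y hy i, hedge y hy (i + 1), by linarith⟩
  -- existence
  have hex : ∀ i, ∃ y ∈ peel W, y ∈ triAt hm q i ∧ ∀ y' ∈ peel W, y' ∈ triAt hm q i → y' = y := by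
    intro i
    obtain ⟨y, ⟨h1, h2⟩, h3⟩ := hu _ (hQR i) _ (hQR (i + 1)) _ (hQR (i + 2))
      (hQne _ _ (by omega) (by omega)) (hQne _ _ (by omega) (by omega))
      (hQne _ _ (by omega) (by omega))
    exact ⟨y, h1, h2, fun y' h h' => h3 y' ⟨h, h'⟩⟩
  choose g hgY hgT hgu using hex
  -- the point of each triangle is extreme
  have hgR : ∀ i, g i ∈ extremePts (peel W) := by
    intro i
    by_contra hn
    have h1 : g i ∈ convexHull ℝ (extremePts (peel W)) := by
      rw [hull_extremePts _ hYf]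
      exact subset_convexHull ℝ _ (hgY i)
    have h2 := orient_nonneg_hull (Q i) (Q (i + 2)) _ (fun x hx => by
      by_contra hneg
      push Not at hneg
      have hxY := extremePts_subset _ hx
      exact hn (hgu i x hxY ((hmem x hxY i).2 hneg) ▸ hx)) _ h1
    have h3 := (hmem _ (hgY i) i).1 (hgT i)
    linarith
  -- non-adjacent triangles are disjoint
  have hdisj : ∀ p ∈ peel W, ∀ i l, i < l → l < m → p ∈ triAt hm q i → p ∈ triAt hm q l →
      l = i + 1 ∨ (i = 0 ∧ l = m - 1) := by
    intro p hp i l hil hlm h1 h2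
    by_contra hcon
    have h3 := (hmem p hp i).1 h1
    have h4 : 0 ≤ orient (Q i) (Q (i + 2)) p := by
      refine orient_nonneg_hull (Q i) (Q (i + 2)) _ ?_ p (interior_subset h2)
      have aux : ∀ n, i + 2 ≤ n → n ≤ i + m → 0 ≤ orient (Q i) (Q (i + 2)) (Q n) := by
        intro n hn1 hn2
        rcases Nat.eq_or_lt_of_le hn1 with h | h
        · rw [← h, orient_self_right]
        · rcases Nat.eq_or_lt_of_le hn2 with h' | h'
          · rw [h', hQ, perQ_add, orient_self_left]
          · exact (hor i (i + 2) n (by omega) h h').le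
      rintro x (rfl | rfl | rfl)
      · exact aux l (by omega) (by omega)
      · exact aux (l + 1) (by omega) (by omega)
      · exact aux (l + 2) (by omega) (by omega)
    linarith
  -- |Y| ≤ m - 2
  have hcardY : (peel W).ncard ≤ m - 2 := by
    have hfan : ∀ y ∈ peel W, ∃ t, t < m - 2 ∧
        y ∈ interior (convexHull ℝ ({Q 0, Q (t + 1), Q (t + 2)} : Set Pt)) := by
      intro y hy
      have hlast : ¬ 0 < orient (Q 0) (Q (m - 1)) y := by
        have h1 := hedge y hy (m - 1)
        have h2 : Q (m - 1 + 1) = Q 0 := by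
          rw [Nat.sub_add_cancel (by omega), hQ, ← perQ_add hm q 0, Nat.zero_add]
        rw [h2, orient_swap] at h1
        linarith
      have hexi : ∃ n, ¬ 0 < orient (Q 0) (Q (n + 1)) y :=
        ⟨m - 2, by rw [show m - 2 + 1 = m - 1 by omega]; exact hlast⟩
      have hn1 := Nat.find_spec hexi
      have hn2 : Nat.find hexi ≤ m - 2 :=
        Nat.find_min' hexi (by rw [show m - 2 + 1 = m - 1 by omega]; exact hlast)
      have hn0 : Nat.find hexi ≠ 0 := by
        intro h0
        rw [h0] at hn1
        exact hn1 (hedge y hy 0)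
      obtain ⟨t, ht⟩ := Nat.exists_eq_succ_of_ne_zero hn0
      have hmin := Nat.find_min hexi (m := t) (by omega)
      rw [ht] at hn1
      push Not at hmin hn1
      refine ⟨t, by omega, ?_⟩
      rw [mem_tri_iff _ _ _ _ (hor 0 (t + 1) (t + 2) (by omega) (by omega) (by omega))]
      refine ⟨hmin, hedge y hy (t + 1), ?_⟩
      rw [orient_swap]
      have h5 := hchord y hy 0 (t + 2) (by omega) (by omega)
      have h6 : orient (Q 0) (Q (t + 2)) y ≤ 0 := hn1
      have := lt_of_le_of_ne h6 h5
      linarith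
    choose! τ hτ1 hτ2 using hfan
    rw [Set.ncard_eq_toFinset_card _ hYf]
    rw [← Finset.card_range (m - 2)]
    apply Finset.card_le_card_of_injOn τ
    · intro y hy
      simpa using hτ1 y (by simpa using hy)
    · intro y hy y' hy' he
      have hy := (hYf.mem_toFinset).1 hy
      have hy' := (hYf.mem_toFinset).1 hy'
      have h1 := hτ1 y hy
      obtain ⟨z, -, hz⟩ := hu _ (hQR 0) _ (hQR (τ y + 1)) _ (hQR (τ y + 2))
        (hQne _ _ (by omega) (by omega)) (hQne _ _ (by omega) (by omega))
        (hQne _ _ (by omega) (by omega))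
      rw [hz y ⟨hy, hτ2 y hy⟩, hz y' ⟨hy', by rw [he]; exact hτ2 y' hy'⟩]
  have hinner := card_inner (peel W) hYf
    (fun a ha b hb c hc => hG a (hYW ha) b (hYW hb) c (hYW hc)) hi
  have hRf : (extremePts (peel W)).Finite := hYf.subset (extremePts_subset _)
  have hsum : (extremePts (peel W)).ncard + (peel (peel W)).ncard = (peel W).ncard := by
    rw [add_comm]
    exact Set.ncard_sdiff_add_ncard_of_subset (extremePts_subset _) hYf
  intro p hp
  have hpY := extremePts_subset _ hp
  have h2n : 2 * (extremePts (peel W)).ncard ≤ m := by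
    omega
  -- fibres
  let F : Pt → Finset ℕ := fun r => (Finset.range m).filter fun i => g i = r
  have hFmem : ∀ r i, i ∈ F r ↔ i < m ∧ g i = r := by intro r i; simp [F]
  have hFT : ∀ r ∈ peel W, ∀ i, i ∈ F r ↔ i < m ∧ r ∈ triAt hm q i := by
    intro r hr i
    rw [hFmem]
    refine and_congr_right fun _ => ⟨fun h => h ▸ hgT i, fun h => (hgu i r hr h).symm⟩
  have hF2 : ∀ r ∈ peel W, (F r).card ≤ 2 := by
    intro r hr
    by_contra hcon
    push Not at hcon
    obtain ⟨a, b, c, ha, hb, hc, hab, hac, hbc⟩ := Finset.two_lt_card_iff.1 hcon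
    rw [hFT r hr] at ha hb hc
    have D : ∀ x y, x ≠ y → (x < m ∧ r ∈ triAt hm q x) → (y < m ∧ r ∈ triAt hm q y) →
        (y = x + 1 ∨ (x = 0 ∧ y = m - 1)) ∨ (x = y + 1 ∨ (y = 0 ∧ x = m - 1)) := by
      intro x y hxy hx hy
      rcases Nat.lt_or_gt_of_ne hxy with h | h
      · exact Or.inl (hdisj r hr x y h hy.1 hx.2 hy.2)
      · exact Or.inr (hdisj r hr y x h hx.1 hy.2 hx.2)
    have := D a b hab ha hb
    have := D a c hac ha hc
    have := D b c hbc hb hc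
    omega
  have hFp : 2 ≤ (F p).card := by
    by_contra hcon
    push Not at hcon
    have h1 : (Finset.range m).card = ∑ r ∈ hRf.toFinset, (F r).card :=
      Finset.card_eq_sum_card_fiberwise (fun i _ => by simpa using hgR i)
    have h2 : ∑ r ∈ hRf.toFinset, (F r).card < ∑ r ∈ hRf.toFinset, 2 := by
      apply Finset.sum_lt_sum
      · intro r hr
        exact hF2 r (extremePts_subset _ ((hRf.mem_toFinset).1 hr))
      · exact ⟨p, (hRf.mem_toFinset).2 hp, hcon⟩
    rw [Finset.sum_const, smul_eq_mul, ← Set.ncard_eq_toFinset_card _ hRf] at h2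
    rw [Finset.card_range] at h1
    omega
  obtain ⟨a, b, ha, hb, hab⟩ : ∃ a b, a ∈ F p ∧ b ∈ F p ∧ a < b := by
    obtain ⟨a, ha, b, hb, hab⟩ := Finset.one_lt_card.1 hFp
    rcases Nat.lt_or_gt_of_ne hab with h | h
    · exact ⟨a, b, ha, hb, h⟩
    · exact ⟨b, a, hb, ha, h⟩
  have honly : ∀ l, l < m → l ≠ a → l ≠ b → p ∉ triAt hm q l := by
    intro l hl hla hlb hT
    have h3 : ({a, b, l} : Finset ℕ) ⊆ F p := by
      intro x hx
      simp only [Finset.mem_insert, Finset.mem_singleton] at hx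
      rcases hx with rfl | rfl | rfl
      · exact ha
      · exact hb
      · exact (hFT p hpY _).2 ⟨hl, hT⟩
    have h4 := Finset.card_le_card h3
    rw [Finset.card_eq_three.2 ⟨a, b, l, hab.ne, hla.symm, hlb.symm, rfl⟩] at h4
    have := hF2 p hpY
    omega
  rw [hFT p hpY] at ha hb
  rcases hdisj p hpY a b hab hb.1 ha.2 hb.2 with h | ⟨h, h'⟩
  · subst h
    refine ⟨a, ha.1, ha.2, hb.2, fun l hl h1 h2 => honly l hl h1 ?_⟩
    rwa [Nat.mod_eq_of_lt hb.1] at h2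
  · subst h
    have hbm : b + 1 = m := by omega
    refine ⟨b, hb.1, hb.2, ?_, fun l hl h1 h2 => honly l hl ?_ h1⟩
    · rw [hmem p hpY, hbm]
      have h5 := (hmem p hpY 0).1 ha.2
      have e1 : Q m = Q 0 := by rw [hQ, ← perQ_add hm q 0, Nat.zero_add]
      have e2 : Q (m + 2) = Q (0 + 2) := by
        rw [hQ, add_comm m 2, perQ_add, Nat.zero_add]
      rw [e1, e2]
      exact h5
    · rwa [hbm, Nat.mod_self] at h2

lemma peel_iter_subset (X : Set Pt) (n : ℕ) : peel^[n] X ⊆ X := by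
  induction n with
  | zero => exact subset_rfl
  | succ n ih =>
    rw [Function.iterate_succ_apply']
    exact Set.sdiff_subset.trans ih

/-- Each point of `R_j` lies in exactly two, consecutive, of the triangles
determined by three consecutive points of `R_{j+1}` (in counterclockwise order). -/
theorem nacs_two_consecutive_triangles (X : Set Pt) (hX : IsNACS X) (k : ℕ)
    (hk : HasLayers X k) (j : ℕ) (hj1 : 1 ≤ j) (hjk : j + 1 ≤ k)
    (m : ℕ) (hm : m = (layer X k (j + 1)).ncard) (hm4 : 4 ≤ m)
    (q : Fin m → Pt) (hq : CCWEnum (layer X k (j + 1)) q) :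
    ∀ p ∈ layer X k j, ∃ i : ℕ, i < m ∧
      p ∈ triAt (show 0 < m by omega) q i ∧
      p ∈ triAt (show 0 < m by omega) q (i + 1) ∧
      ∀ l : ℕ, l < m → l ≠ i → l ≠ (i + 1) % m →
        p ∉ triAt (show 0 < m by omega) q l := by
  obtain ⟨hfin, -, hG, hN⟩ := hX
  have hsub := peel_iter_subset X (k - (j + 1))
  have e1 : layerSub X k j = peel (layerSub X k (j + 1)) := by
    unfold layerSub
    rw [← Function.iterate_succ_apply' peel, show (k - (j + 1)).succ = k - j by omega]
  have e2 : layerSub X k (j - 1) = peel (peel (layerSub X k (j + 1))) := by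
    rw [← e1]
    unfold layerSub
    rw [← Function.iterate_succ_apply' peel, show (k - j).succ = k - (j - 1) by omega]
  have n1 := hN k hk (j + 1) (by omega) hjk
  have n2 := hN k hk j hj1 (by omega)
  rw [Nat.add_sub_cancel, e1] at n1
  unfold layer at n2 ⊢
  rw [e2, e1] at n2
  rw [e1]
  exact core (layerSub X k (j + 1)) (hfin.subset hsub)
    (fun a ha b hb c hc => hG a (hsub ha) b (hsub hb) c (hsub hc)) m hm4 (by omega) q hq n1
    (fun a ha b hb c hc h1 h2 h3 => (n2 a ha b hb c hc h1 h2 h3).exists)
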